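/- Let φ₂ = 1/(γ b² h) and φ₃ satisfy φ₃ = −(1/(γ³h³) + 1/(γ b³ h²) + E₊/(γ b² h³)), and let \varpi₂ = Σ \tilde{b}²/(γ d_a² − ξ)² + (1−c)/b² (per the paper's normalization \varpi₂ = E₊² b² φ₂). Then \varpi₂ = E₊² b² φ₂ follows from \tilde{b} = E₊ b − γ(1−c), ξ = b\tilde{b}, relation (R1), and φ₂ = 1/(γ b² h). -/

import Mathlib

/-- `ϖ₂ = E₊² b² φ₂` from `b̃ = E₊ b − γ(1−c)`, `ξ = b b̃`, relation (R1),
and `φ₂ = 1/(γ b² h)`. -/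
theorem stmt19 (M N : ℕ) (hN : 0 < N) (d : Fin M → ℝ)
    (γ b tb ξ E h c : ℝ) (hγ : γ ≠ 0) (hb : b ≠ 0) (hh : h ≠ 0)
    (hden : ∀ a, γ * d a ^ 2 - ξ ≠ 0)
    (htb : tb = E * b - γ * (1 - c)) (hξ : ξ = b * tb) (hhdef : h = E * b + tb)
    (hφ₂ : (N : ℝ)⁻¹ * ∑ a, ((γ * d a ^ 2 - ξ) ^ 2)⁻¹ = 1 / (γ * b ^ 2 * h))
    (hφ₃ : (N : ℝ)⁻¹ * ∑ a, ((γ * d a ^ 2 - ξ) ^ 3)⁻¹ =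
      -(1 / (γ ^ 3 * h ^ 3) + 1 / (γ * b ^ 3 * h ^ 2) + E / (γ * b ^ 2 * h ^ 3)))
    (hR1 : (N : ℝ)⁻¹ * ∑ a, γ * b * (E * b ^ 2 + ξ) / (γ * d a ^ 2 - ξ) ^ 2 = 1) :
    (N : ℝ)⁻¹ * ∑ a, tb ^ 2 / (γ * d a ^ 2 - ξ) ^ 2 + (1 - c) / b ^ 2 =
      E ^ 2 * b ^ 2 * ((N : ℝ)⁻¹ * ∑ a, ((γ * d a ^ 2 - ξ) ^ 2)⁻¹) := by
  have e : ∑ a, tb ^ 2 / (γ * d a ^ 2 - ξ) ^ 2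
      = tb ^ 2 * ∑ a, ((γ * d a ^ 2 - ξ) ^ 2)⁻¹ := by
    rw [Finset.mul_sum]
    exact Finset.sum_congr rfl fun a _ => div_eq_mul_inv _ _
  rw [e, mul_left_comm, hφ₂]
  have k : E ^ 2 * b ^ 2 - tb ^ 2 = γ * (1 - c) * h := by
    rw [hhdef, htb]; ring
  have k2 : E ^ 2 * b ^ 2 = tb ^ 2 + γ * (1 - c) * h := by linarith
  rw [k2]
  field_simp
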